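/- arXiv:2512.05327 — 4 statements merged into one kernel-verified Lean document; each statement's English description precedes it below -/
import Mathlib

section
/- Let λ > Δ₁, let x, g ∈ ℝ^d, and define F(y) := f₁(y) + h₁(x) + ⟨g − ∇f₁(x), y − x⟩ + (λ/2)‖y − x‖². Then for every y ∈ ℝ^d: F(x) − F(y) ≤ f(x) − f(y) + ‖g − ∇f(x)‖² / (2(λ − Δ₁)). -/
open scoped RealInnerProductSpace BigOperators

/-- Descent lemma. -/
theorem descent_aux {E : Type*} [NormedAddCommGroup E] [InnerProductSpace ℝ E] [CompleteSpace E]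
    (h : E → ℝ) (hd : Differentiable ℝ h) (D : ℝ)
    (hL : ∀ x y, ‖gradient h x - gradient h y‖ ≤ D * ‖x - y‖) (x v : E) :
    h (x + v) ≤ h x + ⟪gradient h x, v⟫ + D / 2 * ‖v‖ ^ 2 := by
  have hder : ∀ t : ℝ, HasDerivAt
      (fun t : ℝ => h (x + t • v) - t * ⟪gradient h x, v⟫ - t ^ 2 * (D / 2 * ‖v‖ ^ 2))
      (⟪gradient h (x + t • v), v⟫ - ⟪gradient h x, v⟫ - 2 * t * (D / 2 * ‖v‖ ^ 2)) t := by
    intro t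
    have h1 : HasDerivAt (fun t : ℝ => x + t • v) v t := by
      simpa using ((hasDerivAt_id t).smul_const v).const_add x
    have h2 := (hd (x + t • v)).hasGradientAt.hasFDerivAt.comp_hasDerivAt t h1
    have h3 := (hasDerivAt_id t).mul_const ⟪gradient h x, v⟫
    have h4 := (hasDerivAt_pow 2 t).mul_const (D / 2 * ‖v‖ ^ 2)
    have h5 := (h2.sub h3).sub h4
    refine HasDerivAt.congr_deriv h5 ?_
    simp
  have hanti := antitoneOn_of_deriv_nonpos (convex_Icc (0 : ℝ) 1)
    (fun t _ => (hder t).continuousAt.continuousWithinAt)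
    (fun t _ => (hder t).differentiableAt.differentiableWithinAt) (by
      intro t ht
      rw [interior_Icc] at ht
      rw [(hder t).deriv, ← inner_sub_left]
      have h1 := real_inner_le_norm (gradient h (x + t • v) - gradient h x) v
      have h2 := hL (x + t • v) x
      rw [add_sub_cancel_left, norm_smul, Real.norm_of_nonneg ht.1.le] at h2
      nlinarith [mul_le_mul_of_nonneg_right h2 (norm_nonneg v)])
  have := hanti (Set.left_mem_Icc.2 zero_le_one) (Set.right_mem_Icc.2 zero_le_one) zero_le_one
  simp only [one_smul, zero_smul, add_zero, one_mul, zero_mul, one_pow, sub_zero, ne_eq,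
    OfNat.ofNat_ne_zero, not_false_eq_true, zero_pow] at this
  linarith

/-- model decrease bound for the I-CGM subproblem. -/
theorem icgm_model_bound {d n : ℕ} (hn : 1 ≤ n)
    (f_i : Fin n → EuclideanSpace ℝ (Fin d) → ℝ)
    (hdiff : ∀ i, Differentiable ℝ (f_i i))
    (f : EuclideanSpace ℝ (Fin d) → ℝ)
    (hf : f = fun x => (1 / (n : ℝ)) * ∑ i, f_i i x)
    (h₁ : EuclideanSpace ℝ (Fin d) → ℝ)
    (hh₁ : h₁ = fun x => f x - f_i ⟨0, hn⟩ x)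
    (Δ₁ : ℝ) (hΔ₁ : 0 < Δ₁)
    (hED : ∀ x y, ‖gradient h₁ x - gradient h₁ y‖ ≤ Δ₁ * ‖x - y‖)
    (lam : ℝ) (hlam : Δ₁ < lam)
    (x g : EuclideanSpace ℝ (Fin d))
    (F : EuclideanSpace ℝ (Fin d) → ℝ)
    (hF : F = fun y => f_i ⟨0, hn⟩ y + h₁ x
      + ⟪g - gradient (f_i ⟨0, hn⟩) x, y - x⟫ + (lam / 2) * ‖y - x‖ ^ 2) :
    ∀ y, F x - F y ≤ f x - f y + ‖g - gradient f x‖ ^ 2 / (2 * (lam - Δ₁)) := by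
  intro y
  have hfd : Differentiable ℝ f := by
    rw [hf]
    exact (Differentiable.fun_sum fun i _ => hdiff i).const_mul _
  have hhd : Differentiable ℝ h₁ := by
    rw [hh₁]
    exact hfd.sub (hdiff _)
  have hg : gradient h₁ x = gradient f x - gradient (f_i ⟨0, hn⟩) x := by
    have : fderiv ℝ h₁ x = fderiv ℝ f x - fderiv ℝ (f_i ⟨0, hn⟩) x := by
      rw [hh₁]
      exact fderiv_fun_sub (hfd x) (hdiff _ x)
    simp only [gradient, this, map_sub]
  have hdesc := descent_aux h₁ hhd Δ₁ hED x (y - x)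
  rw [add_sub_cancel, hg] at hdesc
  have hx : h₁ x = f x - f_i ⟨0, hn⟩ x := by rw [hh₁]
  have hy : h₁ y = f y - f_i ⟨0, hn⟩ y := by rw [hh₁]
  have hm : 0 < lam - Δ₁ := sub_pos.2 hlam
  have hyoung : -⟪g - gradient f x, y - x⟫ ≤
      ‖g - gradient f x‖ ^ 2 / (2 * (lam - Δ₁)) + (lam - Δ₁) / 2 * ‖y - x‖ ^ 2 := by
    have h1 := neg_le_of_abs_le (abs_real_inner_le_norm (g - gradient f x) (y - x))
    have h2 : ‖g - gradient f x‖ * ‖y - x‖ ≤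
      ‖g - gradient f x‖ ^ 2 / (2 * (lam - Δ₁)) + (lam - Δ₁) / 2 * ‖y - x‖ ^ 2 := by
      have : ‖g - gradient f x‖ ^ 2 / (2 * (lam - Δ₁)) + (lam - Δ₁) / 2 * ‖y - x‖ ^ 2
          - ‖g - gradient f x‖ * ‖y - x‖
          = (‖g - gradient f x‖ - (lam - Δ₁) * ‖y - x‖) ^ 2 / (2 * (lam - Δ₁)) := by
        field_simp
        ring
      have h3 : 0 ≤ (‖g - gradient f x‖ - (lam - Δ₁) * ‖y - x‖) ^ 2 / (2 * (lam - Δ₁)) := by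
        positivity
      linarith
    linarith
  simp only [hF, sub_self, inner_zero_right, norm_zero]
  simp only [inner_sub_left] at hdesc hyoung ⊢
  linarith
end

section
/- Let x ∈ ℝ^d and let x⁺ be a global minimizer over ℝ^d of the model L(y) := φ(x) + ⟨∇φ(x), y − x⟩ + (L_φ/2)‖y − x‖² + ψ(y). Then F(x) ≥ F(x⁺) + ((L_φ + λ_ψ)/2)‖x⁺ − x‖², and moreover ‖∇F(x⁺)‖ ≤ 2L_φ‖x⁺ − x‖. -/
open scoped RealInnerProductSpace BigOperators

lemma cgm_line {E : Type*} [NormedAddCommGroup E] [NormedSpace ℝ E] (f : E → ℝ)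
    (hf : Differentiable ℝ f) (x w : E) (t : ℝ) :
    HasDerivAt (fun s : ℝ => f (x + s • w)) (fderiv ℝ f (x + t • w) w) t := by
  have h1 : HasDerivAt (fun s : ℝ => x + s • w) w t := by
    simpa using ((hasDerivAt_id t).smul_const w).const_add x
  exact (hf (x + t • w)).hasFDerivAt.comp_hasDerivAt t h1

lemma cgm_descent {d : ℕ} (φ : EuclideanSpace ℝ (Fin d) → ℝ) (K : ℝ)
    (hd : Differentiable ℝ φ)
    (hl : ∀ x y, ‖gradient φ x - gradient φ y‖ ≤ K * ‖x - y‖)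
    (x w : EuclideanSpace ℝ (Fin d)) :
    φ (x + w) ≤ φ x + ⟪gradient φ x, w⟫ + K / 2 * ‖w‖ ^ 2 := by
  have hder : ∀ t : ℝ, HasDerivAt
      (fun s : ℝ => φ (x + s • w) - s * ⟪gradient φ x, w⟫ - K / 2 * ‖w‖ ^ 2 * s ^ 2)
      (fderiv ℝ φ (x + t • w) w - ⟪gradient φ x, w⟫ - K * ‖w‖ ^ 2 * t) t := by
    intro t
    have h := ((cgm_line φ hd x w t).sub
      ((hasDerivAt_id t).mul_const (⟪gradient φ x, w⟫))).sub
      ((hasDerivAt_pow 2 t).const_mul (K / 2 * ‖w‖ ^ 2))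
    refine h.congr_deriv ?_
    simp
    ring
  have hanti := antitoneOn_of_deriv_nonpos (convex_Icc (0 : ℝ) 1)
    (fun t _ => (hder t).continuousAt.continuousWithinAt)
    (fun t _ => (hder t).differentiableAt.differentiableWithinAt)
    (by
      intro t ht
      rw [interior_Icc] at ht
      rw [(hder t).deriv, ← inner_gradient_left, ← inner_sub_left]
      have h1 := real_inner_le_norm (gradient φ (x + t • w) - gradient φ x) w
      have h2 := hl (x + t • w) x
      rw [add_sub_cancel_left, norm_smul, Real.norm_of_nonneg ht.1.le] at h2
      nlinarith [mul_le_mul_of_nonneg_right h2 (norm_nonneg w)])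
  have h := hanti (Set.left_mem_Icc.2 zero_le_one) (Set.right_mem_Icc.2 zero_le_one) zero_le_one
  simp only [one_smul, zero_smul, add_zero] at h
  linarith

lemma cgm_strong {d : ℕ} (ψ : EuclideanSpace ℝ (Fin d) → ℝ) (l : ℝ)
    (hd : Differentiable ℝ ψ)
    (hc : ConvexOn ℝ Set.univ (fun y => ψ y - (l / 2) * ‖y‖ ^ 2))
    (x w : EuclideanSpace ℝ (Fin d)) :
    ψ x + fderiv ℝ ψ x w + l / 2 * ‖w‖ ^ 2 ≤ ψ (x + w) := by
  have hconv : ConvexOn ℝ Set.univ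
      (fun s : ℝ => ψ (x + s • w) - (l / 2) * ‖x + s • w‖ ^ 2) := by
    have h := hc.comp_affineMap (AffineMap.lineMap x (x + w) : ℝ →ᵃ[ℝ] _)
    have e : (fun s : ℝ => ψ (x + s • w) - (l / 2) * ‖x + s • w‖ ^ 2) =
        (fun y => ψ y - (l / 2) * ‖y‖ ^ 2) ∘ (AffineMap.lineMap x (x + w) : ℝ →ᵃ[ℝ] _) := by
      ext s
      simp [AffineMap.lineMap_apply, add_comm]
    rw [e]
    exact h
  have hn : ∀ s : ℝ, ‖x + s • w‖ ^ 2 = ‖x‖ ^ 2 + s * (2 * ⟪x, w⟫) + ‖w‖ ^ 2 * s ^ 2 := by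
    intro s
    rw [norm_add_sq_real, inner_smul_right, norm_smul, mul_pow, Real.norm_eq_abs, sq_abs]
    ring
  have hder : HasDerivAt (fun s : ℝ => ψ (x + s • w) - (l / 2) * ‖x + s • w‖ ^ 2)
      (fderiv ℝ ψ x w - l * ⟪x, w⟫) 0 := by
    simp_rw [hn]
    have h := (cgm_line ψ hd x w 0).sub
      (((((hasDerivAt_id (0 : ℝ)).mul_const (2 * ⟪x, w⟫)).const_add (‖x‖ ^ 2)).add
      ((hasDerivAt_pow 2 (0 : ℝ)).const_mul (‖w‖ ^ 2))).const_mul (l / 2))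
    refine h.congr_deriv ?_
    simp
    ring
  have h := hconv.le_slope_of_hasDerivAt (Set.mem_univ 0) (Set.mem_univ 1) zero_lt_one hder
  have h1 := hn 1
  simp [slope_def_field] at h h1
  rw [h1] at h
  linarith

/-- one step of the composite gradient method. -/
theorem cgm_one_step {d : ℕ}
    (φ ψ : EuclideanSpace ℝ (Fin d) → ℝ)
    (Lφ lamψ : ℝ) (hLφ : 0 < Lφ) (hlamψ : 0 ≤ lamψ)
    (hφdiff : Differentiable ℝ φ)
    (hφlip : ∀ x y, ‖gradient φ x - gradient φ y‖ ≤ Lφ * ‖x - y‖)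
    (hψdiff : Differentiable ℝ ψ)
    (hψsc : ConvexOn ℝ Set.univ (fun y => ψ y - (lamψ / 2) * ‖y‖ ^ 2))
    (F : EuclideanSpace ℝ (Fin d) → ℝ) (hFdef : F = fun y => φ y + ψ y)
    (x xp : EuclideanSpace ℝ (Fin d))
    (L : EuclideanSpace ℝ (Fin d) → ℝ)
    (hL : L = fun y => φ x + ⟪gradient φ x, y - x⟫ + (Lφ / 2) * ‖y - x‖ ^ 2 + ψ y)
    (hmin : ∀ y, L xp ≤ L y) :
    F x ≥ F xp + ((Lφ + lamψ) / 2) * ‖xp - x‖ ^ 2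
      ∧ ‖gradient F xp‖ ≤ 2 * Lφ * ‖xp - x‖ := by
  have hfermat : ∀ v, ⟪gradient φ x, v⟫ + Lφ * ⟪xp - x, v⟫ + fderiv ℝ ψ xp v = 0 := by
    intro v
    have hLl : ∀ s : ℝ, L (xp + s • v) = (φ x + ⟪gradient φ x, xp - x⟫
        + Lφ / 2 * ‖xp - x‖ ^ 2) + s * (⟪gradient φ x, v⟫ + Lφ * ⟪xp - x, v⟫)
        + Lφ / 2 * ‖v‖ ^ 2 * s ^ 2 + ψ (xp + s • v) := by
      intro s
      rw [hL]
      simp only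
      rw [add_sub_right_comm, norm_add_sq_real, inner_add_right, inner_smul_right,
        inner_smul_right, norm_smul, mul_pow, Real.norm_eq_abs, sq_abs]
      ring
    have hder : HasDerivAt (fun s : ℝ => L (xp + s • v))
        (⟪gradient φ x, v⟫ + Lφ * ⟪xp - x, v⟫ + fderiv ℝ ψ xp v) 0 := by
      simp_rw [hLl]
      have h := ((((hasDerivAt_id (0 : ℝ)).mul_const
        (⟪gradient φ x, v⟫ + Lφ * ⟪xp - x, v⟫)).const_add (φ x + ⟪gradient φ x, xp - x⟫
        + Lφ / 2 * ‖xp - x‖ ^ 2)).add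
        ((hasDerivAt_pow 2 (0 : ℝ)).const_mul (Lφ / 2 * ‖v‖ ^ 2))).add
        (cgm_line ψ hψdiff xp v 0)
      refine h.congr_deriv ?_
      simp
    refine IsLocalMin.hasDerivAt_eq_zero (Filter.Eventually.of_forall fun s => ?_) hder
    simpa using hmin (xp + s • v)
  constructor
  · have h1 := cgm_descent φ Lφ hφdiff hφlip x (xp - x)
    have h2 := cgm_strong ψ lamψ hψdiff hψsc xp (x - xp)
    have h3 := hfermat (xp - x)
    rw [← neg_sub xp x, map_neg, norm_neg] at h2
    rw [real_inner_self_eq_norm_sq] at h3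
    simp only [neg_sub, add_sub_cancel] at h1 h2
    rw [hFdef]
    simp only
    linarith
  · have hg : gradient F xp = (gradient φ xp - gradient φ x) - Lφ • (xp - x) := by
      refine ext_inner_right ℝ fun v => ?_
      rw [inner_gradient_left, hFdef, fderiv_fun_add (hφdiff xp) (hψdiff xp), inner_sub_left,
        inner_sub_left, inner_gradient_left, real_inner_smul_left, add_apply]
      linarith [hfermat v]
    rw [hg]
    have h1 := norm_sub_le (gradient φ xp - gradient φ x) (Lφ • (xp - x))
    rw [norm_smul, Real.norm_of_nonneg hLφ.le] at h1
    linarith [hφlip xp x]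
end

section
/- Let K ≥ 1 and let x₀, x₁, …, x_K ∈ ℝ^d be such that for each k = 0,…,K−1, x_{k+1} is a global minimizer over ℝ^d of y ↦ φ(x_k) + ⟨∇φ(x_k), y − x_k⟩ + (L_φ/2)‖y − x_k‖² + ψ(y). Then min_{1 ≤ k ≤ K} ‖∇F(x_k)‖² ≤ 8 L_φ² (F(x₀) − F(x_K)) / ((L_φ + λ_ψ) K). -/
open scoped RealInnerProductSpace BigOperators

lemma descent_aux_s5 {d : ℕ} (φ : EuclideanSpace ℝ (Fin d) → ℝ) (L : ℝ)
    (hd : Differentiable ℝ φ)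
    (hlip : ∀ x y, ‖gradient φ x - gradient φ y‖ ≤ L * ‖x - y‖)
    (x v : EuclideanSpace ℝ (Fin d)) :
    φ (x + v) ≤ φ x + ⟪gradient φ x, v⟫ + (L / 2) * ‖v‖ ^ 2 := by
  have hder : ∀ t : ℝ, HasDerivAt
      (fun t : ℝ => φ (x + t • v) - t * ⟪gradient φ x, v⟫ - (L / 2) * ‖v‖ ^ 2 * t ^ 2)
      (⟪gradient φ (x + t • v), v⟫ - ⟪gradient φ x, v⟫ - L * ‖v‖ ^ 2 * t) t := by
    intro t
    have h1 : HasDerivAt (fun t : ℝ => x + t • v) v t := by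
      simpa using ((hasDerivAt_id t).smul_const v).const_add x
    have h2 : HasDerivAt (fun t : ℝ => φ (x + t • v)) ⟪gradient φ (x + t • v), v⟫ t := by
      have h := (hd (x + t • v)).hasGradientAt.hasFDerivAt.comp_hasDerivAt t h1
      exact h
    have h3 : HasDerivAt (fun t : ℝ => t * ⟪gradient φ x, v⟫) ⟪gradient φ x, v⟫ t := by
      simpa using (hasDerivAt_id t).mul_const ⟪gradient φ x, v⟫
    have h4 : HasDerivAt (fun t : ℝ => (L / 2) * ‖v‖ ^ 2 * t ^ 2) (L * ‖v‖ ^ 2 * t) t := by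
      have h := (hasDerivAt_pow 2 t).const_mul ((L / 2) * ‖v‖ ^ 2)
      have e : (L / 2) * ‖v‖ ^ 2 * (((2 : ℕ) : ℝ) * t ^ (2 - 1)) = L * ‖v‖ ^ 2 * t := by
        norm_num
        ring
      rwa [e] at h
    exact (h2.sub h3).sub h4
  have hanti := antitoneOn_of_deriv_nonpos (convex_Icc (0 : ℝ) 1)
    (fun t _ => (hder t).continuousAt.continuousWithinAt)
    (fun t _ => (hder t).differentiableAt.differentiableWithinAt)
    (by
      intro t ht
      rw [interior_Icc] at ht
      rw [(hder t).deriv, ← inner_sub_left]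
      have h1 := real_inner_le_norm (gradient φ (x + t • v) - gradient φ x) v
      have h2 := hlip (x + t • v) x
      rw [add_sub_cancel_left, norm_smul, Real.norm_of_nonneg ht.1.le] at h2
      nlinarith [norm_nonneg v, mul_le_mul_of_nonneg_right h2 (norm_nonneg v)])
  have h := hanti (Set.left_mem_Icc.2 zero_le_one) (Set.right_mem_Icc.2 zero_le_one) zero_le_one
  simp only [one_smul, zero_smul, add_zero] at h
  linarith

lemma step_decrease {d : ℕ} (φ ψ : EuclideanSpace ℝ (Fin d) → ℝ) (L lam : ℝ)
    (hd : Differentiable ℝ φ)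
    (hlip : ∀ x y, ‖gradient φ x - gradient φ y‖ ≤ L * ‖x - y‖)
    (hψsc : ConvexOn ℝ Set.univ (fun y => ψ y - (lam / 2) * ‖y‖ ^ 2))
    (x z : EuclideanSpace ℝ (Fin d))
    (hmin : ∀ y, φ x + ⟪gradient φ x, z - x⟫ + (L / 2) * ‖z - x‖ ^ 2 + ψ z
      ≤ φ x + ⟪gradient φ x, y - x⟫ + (L / 2) * ‖y - x‖ ^ 2 + ψ y) :
    (L + lam) / 2 * ‖z - x‖ ^ 2 ≤ (φ x + ψ x) - (φ z + ψ z) := by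
  have hdesc := descent_aux_s5 φ L hd hlip x (z - x)
  rw [add_sub_cancel] at hdesc
  set r := ‖z - x‖ ^ 2 with hr
  set g := ⟪gradient φ x, z - x⟫ with hg
  have key : ∀ t ∈ Set.Ioo (0 : ℝ) 1,
      (L + lam) / 2 * r * (1 - t) ≤ (φ x + ψ x) - (φ z + ψ z) := by
    intro t ht
    have h1 := hmin ((1 - t) • z + t • x)
    have e : (1 - t) • z + t • x - x = (1 - t) • (z - x) := by module
    rw [e, inner_smul_right, norm_smul, mul_pow, Real.norm_of_nonneg (by linarith [ht.2]),
      ← hr, ← hg] at h1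
    have h2 := hψsc.2 (Set.mem_univ z) (Set.mem_univ x) (by linarith [ht.2] : 0 ≤ 1 - t)
      ht.1.le (by ring)
    simp only [smul_eq_mul] at h2
    have h3 : ‖(1 - t) • z + t • x‖ ^ 2 = (1 - t) * ‖z‖ ^ 2 + t * ‖x‖ ^ 2 - t * (1 - t) * r := by
      rw [hr, norm_add_sq_real, norm_sub_sq_real, norm_smul, norm_smul, inner_smul_left,
        inner_smul_right, mul_pow, mul_pow]
      simp
      ring
    rw [h3] at h2
    have : 0 ≤ t * ((φ x + ψ x) - (φ z + ψ z) - (L + lam) / 2 * r * (1 - t)) := by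
      have := mul_le_mul_of_nonneg_left hdesc ht.1.le
      nlinarith
    have := nonneg_of_mul_nonneg_right this ht.1
    linarith
  have hlim : Filter.Tendsto (fun t : ℝ => (L + lam) / 2 * r * (1 - t)) (nhdsWithin 0 (Set.Ioi 0))
      (nhds ((L + lam) / 2 * r)) := by
    have : Continuous (fun t : ℝ => (L + lam) / 2 * r * (1 - t)) := by fun_prop
    have h := this.tendsto 0
    simp only [sub_zero, mul_one] at h
    exact h.mono_left nhdsWithin_le_nhds
  refine le_of_tendsto hlim ?_
  filter_upwards [Ioo_mem_nhdsGT (zero_lt_one (α := ℝ))] with t ht using key t ht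

lemma step_grad {d : ℕ} (φ ψ : EuclideanSpace ℝ (Fin d) → ℝ) (L : ℝ)
    (hL : 0 < L) (hd : Differentiable ℝ φ)
    (hlip : ∀ x y, ‖gradient φ x - gradient φ y‖ ≤ L * ‖x - y‖)
    (hψ : Differentiable ℝ ψ)
    (x z : EuclideanSpace ℝ (Fin d))
    (hmin : ∀ y, φ x + ⟪gradient φ x, z - x⟫ + (L / 2) * ‖z - x‖ ^ 2 + ψ z
      ≤ φ x + ⟪gradient φ x, y - x⟫ + (L / 2) * ‖y - x‖ ^ 2 + ψ y) :
    ‖gradient (fun y => φ y + ψ y) z‖ ^ 2 ≤ 4 * L ^ 2 * ‖z - x‖ ^ 2 := by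
  have hsub : HasFDerivAt (fun y : EuclideanSpace ℝ (Fin d) => y - x)
      (ContinuousLinearMap.id ℝ _) z := (hasFDerivAt_id z).sub_const x
  have h1 := (innerSL ℝ (gradient φ x)).hasFDerivAt.comp z hsub
  have h2 := hsub.norm_sq.const_mul (L / 2)
  have h3 := (hψ z).hasGradientAt.hasFDerivAt
  have h4 := ((h1.const_add (φ x)).add h2).add h3
  have hloc : IsLocalMin (fun y => φ x + ⟪gradient φ x, y - x⟫
      + (L / 2) * ‖y - x‖ ^ 2 + ψ y) z := Filter.Eventually.of_forall hmin
  have h0 := hloc.hasFDerivAt_eq_zero h4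
  have hopt : gradient φ x + L • (z - x) + gradient ψ z = 0 := by
    apply ext_inner_right ℝ
    intro v
    have := congrArg (fun f => f v) h0
    simp at this
    simp [inner_add_left, real_inner_smul_left, inner_sub_left]
    linarith
  have hF : gradient (fun y => φ y + ψ y) z = gradient φ z + gradient ψ z := by
    apply HasGradientAt.gradient
    rw [hasGradientAt_iff_hasFDerivAt, map_add]
    exact (hd z).hasGradientAt.hasFDerivAt.add h3
  have e : gradient φ z + gradient ψ z = (gradient φ z - gradient φ x) - L • (z - x) := by
    have e2 : gradient ψ z = -(gradient φ x + L • (z - x)) := eq_neg_of_add_eq_zero_right hopt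
    rw [e2]
    abel
  have hb : ‖gradient (fun y => φ y + ψ y) z‖ ≤ 2 * L * ‖z - x‖ := by
    rw [hF, e]
    refine (norm_sub_le _ _).trans ?_
    rw [norm_smul, Real.norm_of_nonneg hL.le]
    linarith [hlip z x]
  calc _ ≤ (2 * L * ‖z - x‖) ^ 2 := by gcongr
    _ = _ := by ring

/-- best-iterate gradient bound for K steps of the composite
gradient method. -/
theorem cgm_best_iterate {d : ℕ}
    (φ ψ : EuclideanSpace ℝ (Fin d) → ℝ)
    (Lφ lamψ : ℝ) (hLφ : 0 < Lφ) (hlamψ : 0 ≤ lamψ)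
    (hφdiff : Differentiable ℝ φ)
    (hφlip : ∀ x y, ‖gradient φ x - gradient φ y‖ ≤ Lφ * ‖x - y‖)
    (hψdiff : Differentiable ℝ ψ)
    (hψsc : ConvexOn ℝ Set.univ (fun y => ψ y - (lamψ / 2) * ‖y‖ ^ 2))
    (F : EuclideanSpace ℝ (Fin d) → ℝ) (hFdef : F = fun y => φ y + ψ y)
    (K : ℕ) (hK : 1 ≤ K)
    (x : ℕ → EuclideanSpace ℝ (Fin d))
    (hmin : ∀ k < K, ∀ y,
      φ (x k) + ⟪gradient φ (x k), x (k + 1) - x k⟫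
        + (Lφ / 2) * ‖x (k + 1) - x k‖ ^ 2 + ψ (x (k + 1))
      ≤ φ (x k) + ⟪gradient φ (x k), y - x k⟫
        + (Lφ / 2) * ‖y - x k‖ ^ 2 + ψ y) :
    (Finset.Icc 1 K).inf' (Finset.nonempty_Icc.mpr hK)
        (fun k => ‖gradient F (x k)‖ ^ 2)
      ≤ 8 * Lφ ^ 2 * (F (x 0) - F (x K)) / ((Lφ + lamψ) * K) := by
  subst hFdef
  have hpos : 0 < Lφ + lamψ := by linarith
  have hKpos : (0 : ℝ) < K := by exact_mod_cast hK
  set m := (Finset.Icc 1 K).inf' (Finset.nonempty_Icc.mpr hK)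
        (fun k => ‖gradient (fun y => φ y + ψ y) (x k)‖ ^ 2) with hm
  have hstep : ∀ k ∈ Finset.range K, (Lφ + lamψ) * m ≤ 8 * Lφ ^ 2 *
      ((φ (x k) + ψ (x k)) - (φ (x (k + 1)) + ψ (x (k + 1)))) := by
    intro k hk
    have hk := Finset.mem_range.1 hk
    have h1 := step_decrease φ ψ Lφ lamψ hφdiff hφlip hψsc _ _ (hmin k hk)
    have h2 := step_grad φ ψ Lφ hLφ hφdiff hφlip hψdiff _ _ (hmin k hk)
    have h3 : m ≤ ‖gradient (fun y => φ y + ψ y) (x (k + 1))‖ ^ 2 :=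
      Finset.inf'_le (fun k => ‖gradient (fun y => φ y + ψ y) (x k)‖ ^ 2)
        (Finset.mem_Icc.2 ⟨by omega, by omega⟩)
    have h4 := mul_le_mul_of_nonneg_left (h3.trans h2) hpos.le
    have h5 := mul_le_mul_of_nonneg_left h1 (by positivity : 0 ≤ 8 * Lφ ^ 2)
    linarith
  have hsum := Finset.sum_le_sum hstep
  rw [← Finset.mul_sum, ← Finset.mul_sum, Finset.sum_range_sub' (fun k => φ (x k) + ψ (x k))] at hsum
  simp only [Finset.sum_const, Finset.card_range, nsmul_eq_mul] at hsum
  rw [le_div_iff₀ (by positivity)]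
  linarith
end

section
/- Let f₁, f₂ : ℝ^d → ℝ be differentiable, f := (f₁ + f₂)/2, h_i := f − f_i, and x⁰, x¹ ∈ ℝ^d. Define the SAG averages b¹_{(1)} := (∇f₁(x¹) + ∇f₂(x⁰))/2 and b¹_{(2)} := (∇f₂(x¹) + ∇f₁(x⁰))/2, and the SAGA estimators G¹_{(i)} := ∇f_i(x¹) − ∇f_i(x⁰) + ∇f(x⁰) for i = 1,2. Then (1/2)∑_{i=1}^2 ‖b¹_{(i)} − ∇f(x¹)‖² = (1/8)∑_{i=1}^2 ‖∇f_i(x⁰) − ∇f_i(x¹)‖², whereas (1/2)∑_{i=1}^2 ‖G¹_{(i)} − ∇f(x¹)‖² = (1/2)∑_{i=1}^2 ‖∇h_i(x⁰) − ∇h_i(x¹)‖². (Hence, unlike SAGA, the variance of the SAG estimator is not controlled by the dissimilarity of the h_i.) -/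
open scoped BigOperators

/-- for `n = 2`, `m = 1`, the variance of the SAG estimator is
not controlled by the dissimilarity of the `h_i`, unlike SAGA. -/
theorem sag_vs_saga_variance {d : ℕ}
    (f₁ f₂ : EuclideanSpace ℝ (Fin d) → ℝ)
    (hf₁ : Differentiable ℝ f₁) (hf₂ : Differentiable ℝ f₂)
    (f : EuclideanSpace ℝ (Fin d) → ℝ) (hf : f = fun x => (f₁ x + f₂ x) / 2)
    (h₁ h₂ : EuclideanSpace ℝ (Fin d) → ℝ)
    (hh₁ : h₁ = fun x => f x - f₁ x) (hh₂ : h₂ = fun x => f x - f₂ x)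
    (x0 x1 : EuclideanSpace ℝ (Fin d))
    (b1 b2 G1 G2 : EuclideanSpace ℝ (Fin d))
    (hb1 : b1 = (1 / 2 : ℝ) • (gradient f₁ x1 + gradient f₂ x0))
    (hb2 : b2 = (1 / 2 : ℝ) • (gradient f₂ x1 + gradient f₁ x0))
    (hG1 : G1 = gradient f₁ x1 - gradient f₁ x0 + gradient f x0)
    (hG2 : G2 = gradient f₂ x1 - gradient f₂ x0 + gradient f x0) :
    (1 / 2 : ℝ) * (‖b1 - gradient f x1‖ ^ 2 + ‖b2 - gradient f x1‖ ^ 2)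
      = (1 / 8 : ℝ) * (‖gradient f₁ x0 - gradient f₁ x1‖ ^ 2
          + ‖gradient f₂ x0 - gradient f₂ x1‖ ^ 2)
    ∧ (1 / 2 : ℝ) * (‖G1 - gradient f x1‖ ^ 2 + ‖G2 - gradient f x1‖ ^ 2)
      = (1 / 2 : ℝ) * (‖gradient h₁ x0 - gradient h₁ x1‖ ^ 2
          + ‖gradient h₂ x0 - gradient h₂ x1‖ ^ 2) := by
  have key : ∀ x, gradient f x = (1 / 2 : ℝ) • (gradient f₁ x + gradient f₂ x) := by
    intro x
    have e : f = fun x => (1 / 2 : ℝ) • (f₁ x + f₂ x) := by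
      rw [hf]; funext y; simp only [smul_eq_mul]; ring
    have h := (((hf₁ x).hasFDerivAt.add (hf₂ x).hasFDerivAt).const_smul (1 / 2 : ℝ)).fderiv
    have e2 : fderiv ℝ f x = (1 / 2 : ℝ) • (fderiv ℝ f₁ x + fderiv ℝ f₂ x) := by
      rw [e]; exact h
    unfold gradient
    rw [e2, map_smulₛₗ, map_add]
    simp
  have hfd : Differentiable ℝ f := by
    rw [hf]; fun_prop
  have sub : ∀ g : EuclideanSpace ℝ (Fin d) → ℝ, Differentiable ℝ g → ∀ x,
      gradient (fun x => f x - g x) x = gradient f x - gradient g x := by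
    intro g hg x
    have e2 : fderiv ℝ (fun x => f x - g x) x = fderiv ℝ f x - fderiv ℝ g x :=
      ((hfd x).hasFDerivAt.sub (hg x).hasFDerivAt).fderiv
    unfold gradient
    rw [e2, map_sub]
  constructor
  · have a1 : b1 - gradient f x1 = (1 / 2 : ℝ) • (gradient f₂ x0 - gradient f₂ x1) := by
      rw [hb1, key]; module
    have a2 : b2 - gradient f x1 = (1 / 2 : ℝ) • (gradient f₁ x0 - gradient f₁ x1) := by
      rw [hb2, key]; module
    rw [a1, a2, norm_smul, norm_smul, mul_pow, mul_pow]
    norm_num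
    ring
  · have a1 : G1 - gradient f x1 = gradient h₁ x0 - gradient h₁ x1 := by
      rw [hG1, hh₁, sub f₁ hf₁, sub f₁ hf₁]; abel
    have a2 : G2 - gradient f x1 = gradient h₂ x0 - gradient h₂ x1 := by
      rw [hG2, hh₂, sub f₂ hf₂, sub f₂ hf₂]; abel
    rw [a1, a2]
end
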